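/- arXiv:1101.0233 — 2 statements merged into one kernel-verified Lean document; each statement's English description precedes it below -/
import Mathlib

section
/- The subgroup AM_{1,1,0} of Aut(F_2) consisting of all automorphisms φ of the free group F_2 with basis x, y such that φ(x^{-1}y^{-1}xy) = x^{-1}y^{-1}xy is isomorphic to the group with presentation ⟨a, b ∣ a·a = b·a·b⟩. -/
/-- The commutator `[x,y] = x⁻¹y⁻¹xy` of the two generators of the free group `F₂`. -/
def commXY : FreeGroup (Fin 2) :=
  (FreeGroup.of 0)⁻¹ * (FreeGroup.of 1)⁻¹ * FreeGroup.of 0 * FreeGroup.of 1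

/-- The single relation `a·a·(b·a·b)⁻¹` in the free group on `a, b`
(with `a = FreeGroup.of 0` and `b = FreeGroup.of 1`). -/
def relAM110 : Set (FreeGroup (Fin 2)) :=
  {FreeGroup.of 0 * FreeGroup.of 0 *
    (FreeGroup.of 1 * FreeGroup.of 0 * FreeGroup.of 1)⁻¹}

namespace AM110

open Matrix.SpecialLinearGroup
open scoped MatrixGroups

/-! ### Words alternating between powers of `a` and `s` when `s² = a³` -/

section Reduced

variable {G : Type*} [Group G]

/-- Products `aⁿ s a^{±1} s ⋯ a^{±1} s`. -/
inductive IsReduced (a s : G) : G → Prop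
  | base (n : ℤ) : IsReduced a s (a ^ n * s)
  | mul_right {h : G} : IsReduced a s h → IsReduced a s (h * a * s)
  | inv_mul_right {h : G} : IsReduced a s h → IsReduced a s (h * a⁻¹ * s)

variable {a s : G}

lemma IsReduced.zpow_mul_left {h : G} (hh : IsReduced a s h) (m : ℤ) :
    IsReduced a s (a ^ m * h) := by
  induction hh with
  | base n => rw [← mul_assoc, ← zpow_add]; exact .base _
  | mul_right _ ih => simpa only [mul_assoc] using ih.mul_right
  | inv_mul_right _ ih => simpa only [mul_assoc] using ih.inv_mul_right

lemma IsReduced.commute_cube (hs : s * s = a ^ 3) {h : G} (hh : IsReduced a s h) :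
    Commute (a ^ 3) h := by
  have ha : Commute (a ^ 3) a := (Commute.refl a).pow_left 3
  have hs' : Commute (a ^ 3) s := by
    rw [← hs]; exact (Commute.refl s).mul_left (Commute.refl s)
  induction hh with
  | base n => exact (ha.zpow_right n).mul_right hs'
  | mul_right _ ih => exact (ih.mul_right ha).mul_right hs'
  | inv_mul_right _ ih => exact (ih.mul_right ha.inv_right).mul_right hs'

lemma IsReduced.map {H : Type*} [Group H] (f : G →* H) {h : G}
    (hh : IsReduced a s h) : IsReduced (f a) (f s) (f h) := by
  induction hh with
  | base n => rw [map_mul, map_zpow]; exact .base n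
  | mul_right _ ih => rw [map_mul, map_mul]; exact ih.mul_right
  | inv_mul_right _ ih => rw [map_mul, map_mul, map_inv]; exact ih.inv_mul_right

/-- Elements of the form `aⁿ` or `h aⁿ` with `h` reduced. -/
def HasNormalForm (a s g : G) : Prop :=
  ∃ n : ℤ, g = a ^ n ∨ ∃ h, IsReduced a s h ∧ g = h * a ^ n

lemma HasNormalForm.mul_zpow {g : G} (hg : HasNormalForm a s g) (m : ℤ) :
    HasNormalForm a s (g * a ^ m) := by
  obtain ⟨n, rfl | ⟨h, hh, rfl⟩⟩ := hg
  · exact ⟨n + m, .inl (zpow_add ..).symm⟩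
  · exact ⟨n + m, .inr ⟨h, hh, by rw [mul_assoc, ← zpow_add]⟩⟩

lemma IsReduced.hasNormalForm_mul (hs : s * s = a ^ 3) {h : G} (hh : IsReduced a s h) :
    HasNormalForm a s (h * s) := by
  have hs' : s * s = a ^ (3 : ℤ) := by rw [hs]; norm_cast
  cases hh with
  | base n => exact ⟨n + 3, .inl (by rw [mul_assoc, hs', zpow_add])⟩
  | mul_right hh' =>
    exact ⟨4, .inr ⟨_, hh', by rw [mul_assoc _ s, hs', mul_assoc, ← zpow_one_add]; norm_num⟩⟩
  | inv_mul_right hh' =>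
    refine ⟨2, .inr ⟨_, hh', ?_⟩⟩
    rw [mul_assoc _ s, hs', mul_assoc, ← zpow_neg_one, ← zpow_add]; norm_num

lemma HasNormalForm.mul_right (hs : s * s = a ^ 3) {g : G} (hg : HasNormalForm a s g) :
    HasNormalForm a s (g * s) := by
  obtain ⟨n, rfl | ⟨h, hh, rfl⟩⟩ := hg
  · exact ⟨0, .inr ⟨_, .base n, by simp⟩⟩
  have key (k j : ℤ) : h * a ^ (3 * k + j) = a ^ (3 * k) * h * a ^ j := by
    have : Commute (a ^ (3 * k)) h := by
      rw [zpow_mul]; exact_mod_cast (hh.commute_cube hs).zpow_left k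
    rw [this.eq, zpow_add, mul_assoc]
  obtain ⟨k, hk | hk | hk⟩ : ∃ k, n = 3 * k + 0 ∨ n = 3 * k + 1 ∨ n = 3 * k + -1 :=
    ⟨(n + 1) / 3, by omega⟩
  · rw [hk, key, zpow_zero, mul_one]
    exact (hh.zpow_mul_left _).hasNormalForm_mul hs
  · rw [hk, key, zpow_one]
    exact ⟨0, .inr ⟨_, (hh.zpow_mul_left (3 * k)).mul_right, by simp⟩⟩
  · rw [hk, key, zpow_neg_one]
    exact ⟨0, .inr ⟨_, (hh.zpow_mul_left (3 * k)).inv_mul_right, by simp⟩⟩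

end Reduced

/-! ### The presented group -/

/-- The generator `a` of the presented group. -/
def genA : PresentedGroup relAM110 := PresentedGroup.of 0

/-- The generator `b` of the presented group. -/
def genB : PresentedGroup relAM110 := PresentedGroup.of 1

lemma genA_mul_genA : genA * genA = genB * genA * genB :=
  PresentedGroup.mk_eq_mk_of_mul_inv_mem (rels := relAM110)
    (x := FreeGroup.of 0 * FreeGroup.of 0)
    (y := FreeGroup.of 1 * FreeGroup.of 0 * FreeGroup.of 1) rfl

lemma genAB_sq : genA * genB * (genA * genB) = genA ^ 3 := by
  rw [pow_succ', pow_two, genA_mul_genA]; group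

lemma hasNormalForm (g : PresentedGroup relAM110) : HasNormalForm genA (genA * genB) g := by
  have hs := genAB_sq
  have hg : g ∈ Subgroup.closure (Set.range (PresentedGroup.of (rels := relAM110))) := by
    rw [PresentedGroup.closure_range_of]; trivial
  induction hg using Subgroup.closure_induction_right with
  | one => exact ⟨0, .inl (by simp)⟩
  | mul_right x y hx hy ih =>
    obtain ⟨i, rfl⟩ := hy
    fin_cases i
    · have := ih.mul_zpow 1
      rwa [zpow_one] at this
    · have := (ih.mul_zpow (-1)).mul_right hs
      rwa [zpow_neg_one, mul_assoc, inv_mul_cancel_left] at this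
  | mul_inv_cancel x y hx hy ih =>
    obtain ⟨i, rfl⟩ := hy
    fin_cases i
    · have := ih.mul_zpow (-1)
      rwa [zpow_neg_one] at this
    · have := ((ih.mul_zpow (-3)).mul_right hs).mul_zpow 1
      have e : genB⁻¹ = genA ^ (-3 : ℤ) * (genA * genB) * genA ^ (1 : ℤ) := by
        rw [zpow_neg, show genA ^ (3 : ℤ) = genA ^ 3 by norm_cast, ← genAB_sq]; group
      rw [mul_assoc, mul_assoc, ← mul_assoc (genA ^ (-3 : ℤ)), ← e] at this
      exact this

/-! ### Automorphisms of the free group of rank two -/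

/-- The free group of rank two. -/
abbrev F₂ := FreeGroup (Fin 2)

/-- The first free generator. -/
abbrev x : F₂ := FreeGroup.of 0

/-- The second free generator. -/
abbrev y : F₂ := FreeGroup.of 1

lemma mulAut_ext {φ ψ : MulAut F₂} (hx : φ x = ψ x) (hy : φ y = ψ y) : φ = ψ := by
  have : (φ : F₂ →* F₂) = ψ := by
    ext i
    fin_cases i
    exacts [hx, hy]
  exact MulEquiv.toMonoidHom_injective this

/-- The automorphism `x ↦ y⁻¹, y ↦ xy`. -/
def autA : MulAut F₂ :=
  MonoidHom.toMulEquiv (FreeGroup.lift ![y⁻¹, x * y]) (FreeGroup.lift ![y * x, x⁻¹])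
    (by ext i; fin_cases i <;> simp) (by ext i; fin_cases i <;> simp)

/-- The automorphism `x ↦ x, y ↦ xy`. -/
def autB : MulAut F₂ :=
  MonoidHom.toMulEquiv (FreeGroup.lift ![x, x * y]) (FreeGroup.lift ![x, x⁻¹ * y])
    (by ext i; fin_cases i <;> simp) (by ext i; fin_cases i <;> simp)

@[simp] lemma autA_x : autA x = y⁻¹ := by simp [autA]
@[simp] lemma autA_y : autA y = x * y := by simp [autA]
@[simp] lemma autB_x : autB x = x := by simp [autB]
@[simp] lemma autB_y : autB y = x * y := by simp [autB]

/-- The stabilizer of the commutator `[x, y]` in `Aut F₂`. -/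
abbrev Stab := MulAction.stabilizer (MulAut F₂) commXY

lemma autA_mem : autA ∈ Stab := by
  rw [MulAction.mem_stabilizer_iff, MulAut.smul_def]
  simp only [commXY, map_mul, map_inv, autA_x, autA_y]; group

lemma autB_mem : autB ∈ Stab := by
  rw [MulAction.mem_stabilizer_iff, MulAut.smul_def]
  simp only [commXY, map_mul, map_inv, autB_x, autB_y]; group

lemma autA_mul_autA : autA * autA = autB * autA * autB := by
  apply mulAut_ext <;> simp

/-- The homomorphism from the presented group to the stabilizer. -/
def toStab : PresentedGroup relAM110 →* Stab :=
  PresentedGroup.toGroup (f := ![⟨autA, autA_mem⟩, ⟨autB, autB_mem⟩]) (by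
    rintro _ rfl
    apply Subtype.ext
    simp [autA_mul_autA])

@[simp] lemma toStab_genA : (toStab genA : MulAut F₂) = autA := by
  simp [toStab, genA, PresentedGroup.toGroup.of]

@[simp] lemma toStab_genB : (toStab genB : MulAut F₂) = autB := by
  simp [toStab, genB, PresentedGroup.toGroup.of]

/-! ### A faithful integral representation of the free group -/

lemma det_eq (A : SL(2, ℤ)) : A 0 0 * A 1 1 - A 0 1 * A 1 0 = 1 := by
  rw [← Matrix.det_fin_two]; exact A.det_coe

lemma mul_entry (A B : SL(2, ℤ)) (i j : Fin 2) :
    (A * B) i j = A i 0 * B 0 j + A i 1 * B 1 j := by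
  rw [coe_mul, Matrix.mul_apply, Fin.sum_univ_two]

lemma inv_entries (A : SL(2, ℤ)) :
    A⁻¹ 0 0 = A 1 1 ∧ A⁻¹ 0 1 = -A 0 1 ∧ A⁻¹ 1 0 = -A 1 0 ∧ A⁻¹ 1 1 = A 0 0 := by
  rw [Matrix.SpecialLinearGroup.SL2_inv_expl]; simp

lemma sl_ext {A B : SL(2, ℤ)} (h₀₀ : A 0 0 = B 0 0) (h₀₁ : A 0 1 = B 0 1)
    (h₁₀ : A 1 0 = B 1 0) (h₁₁ : A 1 1 = B 1 1) : A = B := by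
  ext i j
  fin_cases i <;> fin_cases j <;> assumption

/-- The trace of an element of `SL(2, ℤ)`. -/
def tr (A : SL(2, ℤ)) : ℤ := A 0 0 + A 1 1

lemma tr_mul_comm (A B : SL(2, ℤ)) : tr (A * B) = tr (B * A) := by
  simp only [tr, mul_entry]; ring

lemma tr_inv (A : SL(2, ℤ)) : tr A⁻¹ = tr A := by
  obtain ⟨h₁, h₂, h₃, h₄⟩ := inv_entries A
  simp only [tr, h₁, h₄]; ring

lemma tr_inv_mul (A B : SL(2, ℤ)) : tr (A⁻¹ * B) = tr A * tr B - tr (A * B) := by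
  obtain ⟨h₁, h₂, h₃, h₄⟩ := inv_entries A
  simp only [tr, mul_entry, h₁, h₂, h₃, h₄]; ring

lemma tr_mul_mul (A B : SL(2, ℤ)) : tr (A * (A * B)) = tr A * tr (A * B) - tr B := by
  have := tr_inv_mul A (A * B)
  rw [inv_mul_cancel_left] at this
  linarith

lemma tr_conj (A B : SL(2, ℤ)) : tr (A * B * A⁻¹) = tr B := by
  rw [tr_mul_comm, inv_mul_cancel_left]

/-- Fricke's trace identity. -/
lemma tr_commutator (A B : SL(2, ℤ)) :
    tr (A⁻¹ * B⁻¹ * A * B) =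
      tr A ^ 2 + tr B ^ 2 + tr (A * B) ^ 2 - tr A * tr B * tr (A * B) - 2 := by
  have e₁ : tr (A⁻¹ * B⁻¹ * A * B) = tr (B * A) * tr (A * B) - tr (B * A * (A * B)) := by
    rw [← tr_inv_mul]; simp [mul_assoc]
  have e₂ : tr (B * A * (A * B)) = tr (A * (A * (B * B))) := by
    rw [mul_assoc, tr_mul_comm]; simp only [mul_assoc]
  have e₃ := tr_mul_mul A (B * B)
  have e₄ : tr (A * (B * B)) = tr B * tr (A * B) - tr A := by
    rw [tr_mul_comm, mul_assoc, tr_mul_mul, tr_mul_comm B A]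
  have e₅ : tr (B * B) = tr B ^ 2 - 2 := by
    have := tr_mul_mul B 1
    simp only [mul_one] at this
    rw [this]; simp [tr]; ring
  rw [e₁, e₂, e₃, e₄, e₅, tr_mul_comm B A]; ring

/-- The image of `x` under the representation. -/
def matX : SL(2, ℤ) := ⟨!![2, 1; 1, 1], by simp [Matrix.det_fin_two]⟩

/-- The image of `y` under the representation. -/
def matY : SL(2, ℤ) := ⟨!![2, -1; -1, 1], by simp [Matrix.det_fin_two]⟩

/-- The lower unipotent matrix with entry `n`. -/
def matT (n : ℤ) : SL(2, ℤ) := ⟨!![1, 0; n, 1], by simp [Matrix.det_fin_two]⟩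

/-- The representation of the free group as the commutator subgroup of `SL(2, ℤ)`. -/
def rep : F₂ →* SL(2, ℤ) := FreeGroup.lift ![matX, matY]

@[simp] lemma rep_x : rep x = matX := by simp [rep]
@[simp] lemma rep_y : rep y = matY := by simp [rep]

lemma matX_entries : matX 0 0 = 2 ∧ matX 0 1 = 1 ∧ matX 1 0 = 1 ∧ matX 1 1 = 1 := by
  simp [matX]

lemma matY_entries : matY 0 0 = 2 ∧ matY 0 1 = -1 ∧ matY 1 0 = -1 ∧ matY 1 1 = 1 := by
  simp [matY]

lemma matT_entries (n : ℤ) :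
    matT n 0 0 = 1 ∧ matT n 0 1 = 0 ∧ matT n 1 0 = n ∧ matT n 1 1 = 1 := by
  simp [matT]

lemma matT_add (m n : ℤ) : matT (m + n) = matT m * matT n := by
  obtain ⟨h₁, h₂, h₃, h₄⟩ := matT_entries m
  obtain ⟨k₁, k₂, k₃, k₄⟩ := matT_entries n
  obtain ⟨l₁, l₂, l₃, l₄⟩ := matT_entries (m + n)
  apply sl_ext <;> simp only [mul_entry, *] <;> ring

/-- The ping-pong sets: `[1, ∞)` for `x` and `[∞, -1)` for `y`, where a matrix is placed on the
projective line by its first column. -/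
def attract : Fin 2 → Set SL(2, ℤ) :=
  ![{g | (0 < g 1 0 ∧ g 1 0 ≤ g 0 0) ∨ (g 1 0 < 0 ∧ g 0 0 ≤ g 1 0)},
    {g | (0 ≤ g 1 0 ∧ g 0 0 < -g 1 0) ∨ (g 1 0 ≤ 0 ∧ -g 1 0 < g 0 0)}]

/-- The ping-pong sets: `[-1, 0)` for `x⁻¹` and `[0, 1)` for `y⁻¹`. -/
def repel : Fin 2 → Set SL(2, ℤ) :=
  ![{g | (g 0 0 < 0 ∧ -g 0 0 ≤ g 1 0) ∨ (0 < g 0 0 ∧ g 1 0 ≤ -g 0 0)},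
    {g | (0 ≤ g 0 0 ∧ g 0 0 < g 1 0) ∨ (g 0 0 ≤ 0 ∧ g 1 0 < g 0 0)}]

lemma mem_attract_zero (g : SL(2, ℤ)) :
    g ∈ attract 0 ↔ (0 < g 1 0 ∧ g 1 0 ≤ g 0 0) ∨ (g 1 0 < 0 ∧ g 0 0 ≤ g 1 0) := Iff.rfl

lemma mem_attract_one (g : SL(2, ℤ)) :
    g ∈ attract 1 ↔ (0 ≤ g 1 0 ∧ g 0 0 < -g 1 0) ∨ (g 1 0 ≤ 0 ∧ -g 1 0 < g 0 0) := Iff.rfl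

lemma mem_repel_zero (g : SL(2, ℤ)) :
    g ∈ repel 0 ↔ (g 0 0 < 0 ∧ -g 0 0 ≤ g 1 0) ∨ (0 < g 0 0 ∧ g 1 0 ≤ -g 0 0) := Iff.rfl

lemma mem_repel_one (g : SL(2, ℤ)) :
    g ∈ repel 1 ↔ (0 ≤ g 0 0 ∧ g 0 0 < g 1 0) ∨ (g 0 0 ≤ 0 ∧ g 1 0 < g 0 0) := Iff.rfl

lemma col_ne_zero (g : SL(2, ℤ)) : g 0 0 ≠ 0 ∨ g 1 0 ≠ 0 := by
  by_contra! h
  have := det_eq g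
  simp [h.1, h.2] at this

lemma rep_injective : Function.Injective rep := by
  obtain ⟨k₁, k₂, k₃, k₄⟩ := matX_entries
  obtain ⟨l₁, l₂, l₃, l₄⟩ := matY_entries
  obtain ⟨m₁, m₂, m₃, m₄⟩ := inv_entries matX
  obtain ⟨n₁, n₂, n₃, n₄⟩ := inv_entries matY
  refine FreeGroup.injective_lift_of_ping_pong _ attract repel ?_ ?_ ?_ ?_ ?_ ?_
  · rw [Fin.forall_fin_two]
    exact ⟨⟨matX, by rw [mem_attract_zero]; omega⟩, ⟨matY, by rw [mem_attract_one]; omega⟩⟩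
  · simp only [Pairwise, Fin.forall_fin_two, Function.onFun, Set.disjoint_left, mem_attract_zero,
      mem_attract_one]
    grind
  · simp only [Pairwise, Fin.forall_fin_two, Function.onFun, Set.disjoint_left, mem_repel_zero,
      mem_repel_one]
    grind
  · simp only [Fin.forall_fin_two, Set.disjoint_left, mem_attract_zero, mem_attract_one,
      mem_repel_zero, mem_repel_one]
    grind
  · simp only [Fin.forall_fin_two, Set.smul_set_subset_iff, Set.mem_compl_iff, mem_attract_zero,
      mem_attract_one, mem_repel_zero, mem_repel_one, smul_eq_mul, mul_entry, Matrix.cons_val_zero,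
      Matrix.cons_val_one, *]
    constructor <;> intro g hg <;> have := col_ne_zero g <;> omega
  · simp only [Fin.forall_fin_two, Set.smul_set_subset_iff, Set.mem_compl_iff, mem_attract_zero,
      mem_attract_one, mem_repel_zero, mem_repel_one, smul_eq_mul, mul_entry, Matrix.cons_val_zero,
      Matrix.cons_val_one, Pi.inv_apply, *]
    constructor <;> intro g hg <;> have := col_ne_zero g <;> omega

lemma neg_one_notMem_range (w : F₂) : rep w ≠ -1 := by
  intro h
  have h2 : w ^ 2 = 1 := rep_injective (by rw [map_pow, h]; simp)
  rw [pow_eq_one_iff_left two_ne_zero] at h2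
  rw [h2, map_one] at h
  have := congrArg (fun A : SL(2, ℤ) => A 0 0) h
  simp at this

/-! ### The trace triple of an automorphism -/

/-- The trace of the image of a word under an automorphism. -/
def trAut (φ : MulAut F₂) (w : F₂) : ℤ := tr (rep (φ w))

lemma autA_conj (w : F₂) : rep (autA w) = matT 1 * rep w * (matT 1)⁻¹ := by
  have : rep.comp (autA : F₂ →* F₂) =
      (MulAut.conj (matT 1) : SL(2, ℤ) →* SL(2, ℤ)).comp rep := by
    obtain ⟨h₁, h₂, h₃, h₄⟩ := matT_entries 1
    obtain ⟨k₁, k₂, k₃, k₄⟩ := matX_entries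
    obtain ⟨l₁, l₂, l₃, l₄⟩ := matY_entries
    obtain ⟨m₁, m₂, m₃, m₄⟩ := inv_entries (matT 1)
    obtain ⟨n₁, n₂, n₃, n₄⟩ := inv_entries matY
    ext i : 1
    fin_cases i
    · change rep (autA x) = matT 1 * rep x * (matT 1)⁻¹
      rw [autA_x, map_inv, rep_x, rep_y]
      apply sl_ext <;> simp only [mul_entry, *] <;> norm_num
    · change rep (autA y) = matT 1 * rep y * (matT 1)⁻¹
      rw [autA_y, map_mul, rep_x, rep_y]
      apply sl_ext <;> simp only [mul_entry, *] <;> norm_num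
  exact DFunLike.congr_fun this w

lemma autA_zpow_conj (n : ℤ) (w : F₂) :
    rep ((autA ^ n) w) = matT n * rep w * (matT n)⁻¹ := by
  induction n using Int.induction_on with
  | zero =>
    have : matT 0 = 1 := by simpa using matT_add 0 0
    simp [this]
  | succ n ih =>
    rw [add_comm, zpow_one_add, MulAut.mul_apply, autA_conj, ih, matT_add]; group
  | pred n ih =>
    have h := autA_conj ((autA ^ (-(n : ℤ) - 1)) w)
    rw [← MulAut.mul_apply, ← zpow_one_add, add_sub_cancel, ih,
      show -(n : ℤ) = 1 + (-n - 1) by ring, matT_add] at h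
    have h' := congrArg (fun A => (matT 1)⁻¹ * A * matT 1) h
    rw [show -(n : ℤ) - 1 = 1 + (-n - 1) - 1 by ring]
    simp only [mul_assoc, mul_inv_rev, inv_mul_cancel_left, inv_mul_cancel, mul_one] at h' ⊢
    simpa using h'.symm

lemma trAut_autA_zpow (n : ℤ) :
    trAut (autA ^ n) x = 3 ∧ trAut (autA ^ n) y = 3 ∧ trAut (autA ^ n) (x * y) = 3 := by
  obtain ⟨k₁, k₂, k₃, k₄⟩ := matX_entries
  obtain ⟨l₁, l₂, l₃, l₄⟩ := matY_entries
  simp only [trAut, autA_zpow_conj, tr_conj, map_mul rep, rep_x, rep_y]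
  refine ⟨?_, ?_, ?_⟩ <;> simp only [tr, mul_entry, *] <;> norm_num

lemma autA_zpow_eq_one {n : ℤ} (h : autA ^ n = 1) : n = 0 := by
  obtain ⟨h₁, h₂, h₃, h₄⟩ := matT_entries n
  obtain ⟨k₁, k₂, k₃, k₄⟩ := matX_entries
  have e := autA_zpow_conj n x
  rw [h, eq_mul_inv_iff_mul_eq, MulAut.one_apply, rep_x] at e
  have := congrArg (fun A : SL(2, ℤ) => A 0 0) e
  simp only [mul_entry, h₁, h₂, h₃, k₁, k₂, k₃] at this
  linarith

lemma trAut_mul_autA (φ : MulAut F₂) :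
    trAut (φ * autA) x = trAut φ y ∧ trAut (φ * autA) y = trAut φ (x * y) ∧
      trAut (φ * autA) (x * y) = trAut φ x := by
  simp only [trAut, MulAut.mul_apply, map_mul, autA_x, autA_y, map_inv, tr_inv, true_and]
  rw [← mul_assoc, tr_mul_comm, ← mul_assoc, mul_inv_cancel, one_mul]

lemma trAut_mul_autA_inv (φ : MulAut F₂) :
    trAut (φ * autA⁻¹) x = trAut φ (x * y) ∧ trAut (φ * autA⁻¹) y = trAut φ x ∧
      trAut (φ * autA⁻¹) (x * y) = trAut φ y := by
  obtain ⟨h₁, h₂, h₃⟩ := trAut_mul_autA (φ * autA⁻¹)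
  rw [inv_mul_cancel_right] at h₁ h₂ h₃
  exact ⟨h₃.symm, h₁.symm, h₂.symm⟩

lemma trAut_mul_autB (φ : MulAut F₂) :
    trAut (φ * autB) x = trAut φ x ∧ trAut (φ * autB) y = trAut φ (x * y) ∧
      trAut (φ * autB) (x * y) = trAut φ x * trAut φ (x * y) - trAut φ y := by
  simp only [trAut, MulAut.mul_apply, map_mul, autB_x, autB_y, tr_mul_mul, and_self]

lemma trAut_mul_autB_inv (φ : MulAut F₂) :
    trAut (φ * autB⁻¹) x = trAut φ x ∧ trAut (φ * autB⁻¹) (x * y) = trAut φ y ∧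
      trAut (φ * autB⁻¹) y = trAut φ x * trAut φ y - trAut φ (x * y) := by
  obtain ⟨h₁, h₂, h₃⟩ := trAut_mul_autB (φ * autB⁻¹)
  rw [inv_mul_cancel_right] at h₁ h₂ h₃
  refine ⟨h₁.symm, h₂.symm, ?_⟩
  rw [h₁, h₂, h₃]; ring

lemma trAut_mul_autA_mul_autB (φ : MulAut F₂) :
    trAut (φ * (autA * autB)) x = trAut φ y ∧ trAut (φ * (autA * autB)) y = trAut φ x ∧
      trAut (φ * (autA * autB)) (x * y) = trAut φ x * trAut φ y - trAut φ (x * y) := by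
  obtain ⟨h₁, h₂, h₃⟩ := trAut_mul_autA φ
  obtain ⟨k₁, k₂, k₃⟩ := trAut_mul_autB (φ * autA)
  rw [← mul_assoc, k₁, k₂, k₃, h₁, h₂, h₃]
  exact ⟨rfl, rfl, by ring⟩

/-! ### Injectivity -/

lemma trAut_of_isReduced {h : MulAut F₂} (hh : IsReduced autA (autA * autB) h) :
    3 ≤ trAut h x ∧ 3 ≤ trAut h y ∧ trAut h x < trAut h (x * y) ∧
      trAut h y < trAut h (x * y) := by
  induction hh with
  | base n =>
    obtain ⟨h₁, h₂, h₃⟩ := trAut_autA_zpow n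
    obtain ⟨k₁, k₂, k₃⟩ := trAut_mul_autA_mul_autB (autA ^ n)
    rw [k₁, k₂, k₃, h₁, h₂, h₃]; norm_num
  | @mul_right h _ ih =>
    obtain ⟨h₁, h₂, h₃⟩ := trAut_mul_autA h
    obtain ⟨k₁, k₂, k₃⟩ := trAut_mul_autA_mul_autB (h * autA)
    rw [k₁, k₂, k₃, h₁, h₂, h₃]
    obtain ⟨i₁, i₂, i₃, i₄⟩ := ih
    refine ⟨by linarith, by linarith, ?_, ?_⟩ <;> nlinarith
  | @inv_mul_right h _ ih =>
    obtain ⟨h₁, h₂, h₃⟩ := trAut_mul_autA_inv h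
    obtain ⟨k₁, k₂, k₃⟩ := trAut_mul_autA_mul_autB (h * autA⁻¹)
    rw [k₁, k₂, k₃, h₁, h₂, h₃]
    obtain ⟨i₁, i₂, i₃, i₄⟩ := ih
    refine ⟨by linarith, by linarith, ?_, ?_⟩ <;> nlinarith

lemma toStab_injective : Function.Injective toStab := by
  rw [injective_iff_map_eq_one]
  intro g hg
  let f : PresentedGroup relAM110 →* MulAut F₂ := (Subgroup.subtype Stab).comp toStab
  have hA : f genA = autA := toStab_genA
  have hB : f genB = autB := toStab_genB
  have hfg : f g = 1 := by simp [f, hg]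
  obtain ⟨n, rfl | ⟨h, hh, rfl⟩⟩ := hasNormalForm g
  · rw [map_zpow, hA] at hfg
    rw [autA_zpow_eq_one hfg, zpow_zero]
  · have hr := hh.map f
    rw [map_mul, hA, hB] at hr
    rw [map_mul, map_zpow, hA, mul_eq_one_iff_eq_inv, ← zpow_neg] at hfg
    rw [hfg] at hr
    obtain ⟨h₁, h₂, h₃⟩ := trAut_autA_zpow (-n)
    have := trAut_of_isReduced hr
    omega

/-! ### Surjectivity -/

lemma rep_commXY_entries : rep commXY 0 0 = -1 ∧ rep commXY 0 1 = 0 ∧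
    rep commXY 1 0 = 6 ∧ rep commXY 1 1 = -1 := by
  obtain ⟨k₁, k₂, k₃, k₄⟩ := matX_entries
  obtain ⟨l₁, l₂, l₃, l₄⟩ := matY_entries
  obtain ⟨m₁, m₂, m₃, m₄⟩ := inv_entries matX
  obtain ⟨n₁, n₂, n₃, n₄⟩ := inv_entries matY
  simp only [commXY, map_mul, map_inv, rep_x, rep_y, mul_entry, *]
  norm_num

lemma rep_apply_commXY {φ : MulAut F₂} (hφ : φ ∈ Stab) :
    (rep (φ x))⁻¹ * (rep (φ y))⁻¹ * rep (φ x) * rep (φ y) = rep commXY := by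
  have h : φ commXY = commXY := hφ
  rw [← h, commXY]
  simp only [map_mul, map_inv]

lemma markov_equation {φ : MulAut F₂} (hφ : φ ∈ Stab) :
    trAut φ x ^ 2 + trAut φ y ^ 2 + trAut φ (x * y) ^ 2 =
      trAut φ x * trAut φ y * trAut φ (x * y) := by
  have h := tr_commutator (rep (φ x)) (rep (φ y))
  obtain ⟨h₁, h₂, h₃, h₄⟩ := rep_commXY_entries
  rw [rep_apply_commXY hφ, tr, h₁, h₄] at h
  simp only [trAut, map_mul]
  linarith

lemma trAut_x_ne_zero (φ : MulAut F₂) : trAut φ x ≠ 0 := by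
  intro h
  apply neg_one_notMem_range (φ x ^ 2)
  have hd := det_eq (rep (φ x))
  rw [map_pow, pow_two]
  have h' : rep (φ x) 1 1 = -rep (φ x) 0 0 := by
    rw [trAut, tr] at h; linarith
  rw [h'] at hd
  apply sl_ext <;> simp [mul_entry, h'] <;> linarith

/-- A positive solution of the Markov equation `p² + q² + r² = pqr` that no Vieta move makes
smaller is `(3, 3, 3)`. -/
lemma markov_minimal {p q r : ℤ} (hp : 0 < p) (hq : 0 < q) (hr : 0 < r)
    (h : p ^ 2 + q ^ 2 + r ^ 2 = p * q * r) (hpm : p ≤ q * r - p) (hqm : q ≤ p * r - q)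
    (hrm : r ≤ p * q - r) : p = 3 ∧ q = 3 ∧ r = 3 := by
  have key : ∀ p q r : ℤ, 0 < p → p ≤ q → q ≤ r → p ^ 2 + q ^ 2 + r ^ 2 = p * q * r →
      r ≤ p * q - r → p = 3 ∧ q = 3 ∧ r = 3 := by
    intro p q r hp hpq hqr h hr
    have h₁ : 0 ≤ (r - q) * (p * q - r - q) := mul_nonneg (by linarith) (by linarith)
    have h₂ : (p - 2) * q ^ 2 ≤ p ^ 2 := by nlinarith
    have h₃ : p ≤ 3 := by
      by_contra! hc
      nlinarith
    obtain rfl | rfl | rfl : p = 1 ∨ p = 2 ∨ p = 3 := by omega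
    · nlinarith [sq_nonneg (q - r)]
    · nlinarith [sq_nonneg (q - r)]
    · have : q = 3 := by nlinarith
      subst this
      exact ⟨rfl, rfl, by nlinarith⟩
  rcases le_total p q with h₁ | h₁ <;> rcases le_total q r with h₂ | h₂ <;>
    rcases le_total p r with h₃ | h₃
  · exact key p q r hp h₁ h₂ h hrm
  · exact key p q r hp h₁ h₂ h hrm
  · have := key p r q hp h₃ h₂ (by linarith) (by linarith); tauto
  · have := key r p q hr h₃ h₁ (by linarith) (by linarith); tauto
  · have := key q p r hq h₁ h₃ (by linarith) (by linarith); tauto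
  · have := key q r p hq h₂ h₃ (by linarith) (by linarith); tauto
  · have := key r q p hr h₂ h₁ (by linarith) (by linarith); tauto
  · have := key r q p hr h₂ h₁ (by linarith) (by linarith); tauto

/-- A signed solution of the Markov equation is `(±3, ±3, ±3)` or some Vieta move makes it
smaller. -/
lemma markov_descent {p q r : ℤ} (hp : p ≠ 0) (h : p ^ 2 + q ^ 2 + r ^ 2 = p * q * r) :
    (|p| = 3 ∧ |q| = 3 ∧ |r| = 3) ∨ |q * r - p| < |p| ∨ |p * r - q| < |q| ∨
      |p * q - r| < |r| := by
  have hpos : 0 < p * q * r := by rw [← h]; positivity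
  have hq : q ≠ 0 := by rintro rfl; simp at hpos
  have hr : r ≠ 0 := by rintro rfl; simp at hpos
  have habs : |p| * |q| * |r| = p * q * r := by
    rw [← abs_mul, ← abs_mul, abs_of_pos hpos]
  have move : ∀ u v w : ℤ, u ≠ 0 → 0 < u * (v * w) → |v * w - u| < |u| ∨
      |u| ≤ |v| * |w| - |u| := by
    intro u v w hu huv
    rw [← abs_mul]
    rcases lt_or_gt_of_ne hu with hu | hu
    · have : v * w < 0 := by nlinarith
      rw [abs_of_neg hu, abs_of_neg this, abs_lt]; omega
    · have : 0 < v * w := by nlinarith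
      rw [abs_of_pos hu, abs_of_pos this, abs_lt]; omega
  rcases move p q r hp (by linarith) with h₁ | h₁
  · tauto
  rcases move q p r hq (by linarith) with h₂ | h₂
  · tauto
  rcases move r p q hr (by linarith) with h₃ | h₃
  · tauto
  left
  exact markov_minimal (abs_pos.2 hp) (abs_pos.2 hq) (abs_pos.2 hr)
    (by simp only [sq_abs]; linarith) h₁ h₂ h₃

/-- Two words whose matrices agree up to sign are equal. -/
lemma eq_of_rep_eq_or_neg {v w : F₂} (h : rep v = rep w ∨ rep v = -rep w) : v = w := by
  rcases h with h | h
  · exact rep_injective h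
  · refine absurd ?_ (neg_one_notMem_range (v * w⁻¹))
    rw [map_mul, map_inv, h, neg_mul, mul_inv_cancel]

lemma matX_conj_entries (n : ℤ) :
    (matT n * matX * (matT n)⁻¹) 0 0 = 2 - n ∧ (matT n * matX * (matT n)⁻¹) 0 1 = 1 ∧
      (matT n * matX * (matT n)⁻¹) 1 0 = 1 + n - n ^ 2 ∧
      (matT n * matX * (matT n)⁻¹) 1 1 = n + 1 := by
  obtain ⟨h₁, h₂, h₃, h₄⟩ := matT_entries n
  obtain ⟨k₁, k₂, k₃, k₄⟩ := matX_entries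
  obtain ⟨m₁, m₂, m₃, m₄⟩ := inv_entries (matT n)
  simp only [mul_entry, *]
  refine ⟨?_, ?_, ?_, ?_⟩ <;> ring

lemma matY_conj_entries (n : ℤ) :
    (matT n * matY * (matT n)⁻¹) 0 0 = 2 + n ∧ (matT n * matY * (matT n)⁻¹) 0 1 = -1 ∧
      (matT n * matY * (matT n)⁻¹) 1 0 = n ^ 2 + n - 1 ∧
      (matT n * matY * (matT n)⁻¹) 1 1 = 1 - n := by
  obtain ⟨h₁, h₂, h₃, h₄⟩ := matT_entries n
  obtain ⟨k₁, k₂, k₃, k₄⟩ := matY_entries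
  obtain ⟨m₁, m₂, m₃, m₄⟩ := inv_entries (matT n)
  simp only [mul_entry, *]
  refine ⟨?_, ?_, ?_, ?_⟩ <;> ring

lemma eq_matX_conj_or_neg {U : SL(2, ℤ)} (he : |U 0 1| = 1) (ht : tr U = 3 * U 0 1) :
    U = matT (2 - U 0 1 * U 0 0) * matX * (matT (2 - U 0 1 * U 0 0))⁻¹ ∨
      U = -(matT (2 - U 0 1 * U 0 0) * matX * (matT (2 - U 0 1 * U 0 0))⁻¹) := by
  obtain ⟨h₁, h₂, h₃, h₄⟩ := matX_conj_entries (2 - U 0 1 * U 0 0)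
  have hd := det_eq U
  rw [tr] at ht
  have h₁₁ : U 1 1 = 3 * U 0 1 - U 0 0 := by linarith
  rcases (abs_eq zero_le_one).1 he with he | he <;> rw [h₁₁] at hd <;>
    rw [he] at h₁ h₂ h₃ h₄ h₁₁ hd ⊢
  · left
    apply sl_ext <;> simp only [*] <;> linarith
  · right
    apply sl_ext <;> simp only [coe_neg, Matrix.neg_apply, *] <;> linarith

lemma eq_matY_conj_or_neg {V : SL(2, ℤ)} (he : |V 0 1| = 1) (ht : tr V = -3 * V 0 1) :
    V = matT (-V 0 1 * V 0 0 - 2) * matY * (matT (-V 0 1 * V 0 0 - 2))⁻¹ ∨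
      V = -(matT (-V 0 1 * V 0 0 - 2) * matY * (matT (-V 0 1 * V 0 0 - 2))⁻¹) := by
  obtain ⟨h₁, h₂, h₃, h₄⟩ := matY_conj_entries (-V 0 1 * V 0 0 - 2)
  have hd := det_eq V
  rw [tr] at ht
  have h₁₁ : V 1 1 = -3 * V 0 1 - V 0 0 := by linarith
  rcases (abs_eq zero_le_one).1 he with he | he <;> rw [h₁₁] at hd <;>
    rw [he] at h₁ h₂ h₃ h₄ h₁₁ hd ⊢
  · right
    apply sl_ext <;> simp only [coe_neg, Matrix.neg_apply, *] <;> linarith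
  · left
    apply sl_ext <;> simp only [*] <;> linarith

lemma exists_conj_eq_or_neg {U V : SL(2, ℤ)} (hc : U⁻¹ * V⁻¹ * U * V = rep commXY)
    (hp : |tr U| = 3) (hq : |tr V| = 3) (hr : |tr (U * V)| = 3) :
    ∃ n : ℤ, (U = matT n * matX * (matT n)⁻¹ ∨ U = -(matT n * matX * (matT n)⁻¹)) ∧
      (V = matT n * matY * (matT n)⁻¹ ∨ V = -(matT n * matY * (matT n)⁻¹)) := by
  obtain ⟨c₁, c₂, c₃, c₄⟩ := rep_commXY_entries
  obtain ⟨v₁, v₂, v₃, v₄⟩ := inv_entries V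
  have hm := tr_commutator U V
  rw [hc, tr, c₁, c₄] at hm
  have hU : tr U = tr (U * rep commXY) := by
    rw [← tr_conj V⁻¹ U, ← hc]; congr 1; group
  have hV : tr V = tr (rep commXY * V⁻¹) := by
    rw [← tr_inv V, ← tr_conj U⁻¹ V⁻¹, ← hc]; congr 1; group
  have hUV : tr (U * V) = tr (V * U * rep commXY) := by
    rw [← hc]; congr 1; group
  have htr := tr_mul_comm U V
  have hpq : tr U * tr V * tr (U * V) = 27 := by
    have h₁ := sq_abs (tr U)
    have h₂ := sq_abs (tr V)
    have h₃ := sq_abs (tr (U * V))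
    rw [hp] at h₁
    rw [hq] at h₂
    rw [hr] at h₃
    linarith
  clear hm hc hr
  generalize tr (U * V) = r at *
  have hU' : tr U = 3 * U 0 1 := by
    simp only [tr, mul_entry, c₁, c₂, c₃, c₄] at hU ⊢; linarith
  have hV' : tr V = -3 * V 0 1 := by
    simp only [tr, mul_entry, c₁, c₂, c₃, c₄, v₁, v₂, v₃, v₄] at hV ⊢; linarith
  have hUV' : r = 3 * (V 0 0 * U 0 1 + V 0 1 * U 1 1) := by
    simp only [tr, mul_entry, c₁, c₂, c₃, c₄] at hUV htr ⊢; linarith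
  have heU : |U 0 1| = 1 := by
    rw [hU', abs_mul, abs_of_pos (by norm_num)] at hp; linarith
  have heV : |V 0 1| = 1 := by
    rw [hV', abs_mul, abs_of_neg (by norm_num)] at hq; linarith
  have hn : 2 - U 0 1 * U 0 0 = -V 0 1 * V 0 0 - 2 := by
    rw [hU', hV'] at hpq
    rw [tr] at hU'
    rcases (abs_eq zero_le_one).1 heU with h | h <;>
      rcases (abs_eq zero_le_one).1 heV with h' | h' <;>
      rw [h, h'] at hpq hUV' <;> rw [h] at hU' <;> rw [h, h'] <;> linarith
  refine ⟨_, eq_matX_conj_or_neg heU hU', ?_⟩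
  rw [hn]
  exact eq_matY_conj_or_neg heV hV'

lemma exists_eq_zpow_of_abs_tr_eq_three {φ : MulAut F₂} (hφ : φ ∈ Stab) (hp : |trAut φ x| = 3)
    (hq : |trAut φ y| = 3) (hr : |trAut φ (x * y)| = 3) : ∃ n : ℤ, φ = autA ^ n := by
  rw [trAut, map_mul, map_mul] at hr
  obtain ⟨n, hx, hy⟩ := exists_conj_eq_or_neg (rep_apply_commXY hφ) hp hq hr
  rw [← rep_x, ← autA_zpow_conj] at hx
  rw [← rep_y, ← autA_zpow_conj] at hy
  exact ⟨n, mulAut_ext (eq_of_rep_eq_or_neg hx) (eq_of_rep_eq_or_neg hy)⟩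

lemma mem_range_of_abs_tr_le (n : ℕ) (φ : Stab)
    (h : |trAut φ x| + |trAut φ y| + |trAut φ (x * y)| ≤ n) : φ ∈ toStab.range := by
  induction n using Nat.strong_induction_on generalizing φ with
  | _ n ih =>
  have hA : toStab genA ∈ toStab.range := ⟨_, rfl⟩
  have hB : toStab genB ∈ toStab.range := ⟨_, rfl⟩
  have step (ψ : Stab) (hψ : ψ ∈ toStab.range)
      (hlt : |trAut (φ * ψ : Stab) x| + |trAut (φ * ψ : Stab) y| +
        |trAut (φ * ψ : Stab) (x * y)| < n) : φ ∈ toStab.range := by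
    rw [← Subgroup.mul_mem_cancel_right _ hψ]
    have h₀ : 0 ≤ |trAut (φ * ψ : Stab) x| + |trAut (φ * ψ : Stab) y| +
        |trAut (φ * ψ : Stab) (x * y)| := by positivity
    exact ih _ (by omega) _ (Int.toNat_of_nonneg h₀).ge
  rcases markov_descent (trAut_x_ne_zero φ) (markov_equation φ.2) with
    ⟨hp, hq, hr⟩ | hlt | hlt | hlt
  · obtain ⟨k, hk⟩ := exists_eq_zpow_of_abs_tr_eq_three φ.2 hp hq hr
    exact ⟨genA ^ k, Subtype.ext (by simp [hk])⟩
  · refine step (toStab genA⁻¹ * toStab genB) (mul_mem ⟨_, rfl⟩ hB) ?_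
    obtain ⟨h₁, h₂, h₃⟩ := trAut_mul_autA_inv φ
    obtain ⟨k₁, k₂, k₃⟩ := trAut_mul_autB (φ * autA⁻¹)
    simp only [map_inv, Subgroup.coe_mul, Subgroup.coe_inv, toStab_genA, toStab_genB,
      ← mul_assoc, k₁, k₂, k₃, h₁, h₂, h₃]
    rw [mul_comm (trAut φ y)] at hlt
    linarith
  · refine step (toStab genB) hB ?_
    obtain ⟨k₁, k₂, k₃⟩ := trAut_mul_autB φ
    simp only [Subgroup.coe_mul, toStab_genB, k₁, k₂, k₃]
    linarith
  · refine step (toStab genB)⁻¹ (inv_mem hB) ?_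
    obtain ⟨k₁, k₂, k₃⟩ := trAut_mul_autB_inv φ
    simp only [Subgroup.coe_mul, Subgroup.coe_inv, toStab_genB, k₁, k₂, k₃]
    linarith

lemma toStab_surjective : Function.Surjective toStab := fun φ =>
  mem_range_of_abs_tr_le _ φ (Int.toNat_of_nonneg (by positivity)).ge

end AM110

/-- The subgroup `AM_{1,1,0}` of `Aut(F₂)` consisting of the automorphisms fixing the
commutator `x⁻¹y⁻¹xy` is isomorphic to `⟨a, b ∣ a·a = b·a·b⟩`. -/
theorem AM110_iso_presented :
    Nonempty ((MulAction.stabilizer (MulAut (FreeGroup (Fin 2))) commXY) ≃*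
      PresentedGroup relAM110) := by
  exact ⟨(MulEquiv.ofBijective AM110.toStab
    ⟨AM110.toStab_injective, AM110.toStab_surjective⟩).symm⟩
end

section
/- The subgroup AM_{0,1,3} of Aut(F_3) consisting of all automorphisms φ of the free group F_3 with basis t_1, t_2, t_3 such that φ(t_1t_2t_3) = t_1t_2t_3 and φ maps the set of conjugacy classes {[t_1^{-1}], [t_2^{-1}], [t_3^{-1}]} onto itself is isomorphic to the group with presentation ⟨a, b ∣ a·b·a = b·a·b⟩. -/
/-- The word `t₁t₂t₃` in the free group `F₃` on `t₁, t₂, t₃`. -/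
def wordT : FreeGroup (Fin 3) :=
  FreeGroup.of 0 * FreeGroup.of 1 * FreeGroup.of 2

/-- The set of conjugacy classes `{[t₁⁻¹], [t₂⁻¹], [t₃⁻¹]}` in `F₃`. -/
def punctureClasses3 : Set (ConjClasses (FreeGroup (Fin 3))) :=
  Set.range fun k : Fin 3 => ConjClasses.mk (FreeGroup.of k)⁻¹

/-- The set of automorphisms `φ` of `F₃` with `φ(t₁t₂t₃) = t₁t₂t₃` which map the set of
conjugacy classes `{[t₁⁻¹], [t₂⁻¹], [t₃⁻¹]}` onto itself. -/
def AM013carrier : Set (MulAut (FreeGroup (Fin 3))) :=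
  {φ | φ wordT = wordT ∧
    ConjClasses.map φ.toMonoidHom '' punctureClasses3 = punctureClasses3}

/-- The single relation `a·b·a·(b·a·b)⁻¹` in the free group on `a, b`
(with `a = FreeGroup.of 0` and `b = FreeGroup.of 1`). -/
def relAM013 : Set (FreeGroup (Fin 2)) :=
  {FreeGroup.of 0 * FreeGroup.of 1 * FreeGroup.of 0 *
    (FreeGroup.of 1 * FreeGroup.of 0 * FreeGroup.of 1)⁻¹}

namespace FreeGroup

section

variable {α : Type*}

theorem mk_singleton_true (i : α) : mk [(i, true)] = of i := rfl

theorem mk_singleton_false (i : α) : mk [(i, false)] = (of i)⁻¹ := rfl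

theorem mk_cons (a : α × Bool) (w : List (α × Bool)) : mk (a :: w) = mk [a] * mk w := by
  rw [mul_mk, List.singleton_append]

theorem getLast?_cons_invRev_cons (a b : α × Bool) (w : List (α × Bool)) :
    (b :: FreeGroup.invRev (a :: w)).getLast? = some (a.1, !a.2) := by
  rw [invRev_cons, ← List.cons_append]
  exact List.getLast?_concat

/-- The conjugate `w t w⁻¹` of the generator `t = of i` by the element spelled by the word `w`. -/
def conjOf (w : List (α × Bool)) (i : α) : FreeGroup α :=
  mk w * of i * (mk w)⁻¹

/-- A word spells a conjugate of the generator `i` tightly if no cancellation occurs when it is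
followed by that generator or its inverse. -/
def IsTight (w : List (α × Bool)) (i : α) : Prop :=
  ∀ b, IsReduced (w ++ [(i, b)])

end

variable {α : Type*} [DecidableEq α]

theorem IsReduced.invRev {L : List (α × Bool)} (h : IsReduced L) :
    IsReduced (FreeGroup.invRev L) :=
  .of_reduce_eq (by rw [reduce_invRev, h.reduce_eq])

theorem isTight_or_exists_shorter (w : List (α × Bool)) (i : α) :
    IsTight w i ∨ ∃ w', w'.length < w.length ∧ conjOf w' i = conjOf w i := by
  by_cases hw : IsReduced w
  · rcases List.eq_nil_or_concat w with rfl | ⟨u, ⟨j, c⟩, rfl⟩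
    · exact .inl fun b => by simp
    · by_cases hj : j = i
      · subst hj
        refine .inr ⟨u, by simp, ?_⟩
        have : mk (u ++ [(j, c)]) = mk u * mk [(j, c)] := by rw [mul_mk]
        simp only [conjOf, List.concat_eq_append, this]
        cases c
        · rw [mk_singleton_false]; group
        · rw [mk_singleton_true]; group
      · refine .inl fun b => List.isChain_append.2 ⟨hw, List.isChain_singleton _, ?_⟩
        simp [hj]
  · right
    refine ⟨reduce w, ?_, by simp [conjOf, reduce.self]⟩
    refine lt_of_le_of_ne (reduce.red (L := w)).sublist.length_le fun h => hw ?_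
    exact .of_reduce_eq ((reduce.red (L := w)).sublist.eq_of_length h)

theorem exists_gap (w v : List (α × Bool)) (i j : α) (hw : IsTight w i) (hv : IsTight v j) :
    (∃ w', w'.length < w.length ∧ mk w' = (conjOf v j)⁻¹ * mk w) ∨
    (∃ v', v'.length < v.length ∧ mk v' = conjOf w i * mk v) ∨
    ∃ g, mk g = (mk w)⁻¹ * mk v ∧ IsReduced ((i, true) :: (g ++ [(j, true)])) := by
  have hL : ∀ {w : List (α × Bool)} {i : α}, IsTight w i →
      IsReduced ((i, true) :: FreeGroup.invRev w) := fun h => by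
    simpa [FreeGroup.invRev] using (h false).invRev
  induction w generalizing v with
  | nil =>
    cases v with
    | nil => exact .inr (.inr ⟨[], by simp, by simp⟩)
    | cons b v =>
      by_cases hb : b = (i, false)
      · subst hb
        refine .inr (.inl ⟨v, by simp, ?_⟩)
        rw [mk_cons, mk_singleton_false]
        simp [conjOf, ← one_eq_mk]
      · refine .inr (.inr ⟨b :: v, by simp [← one_eq_mk], ?_⟩)
        rw [List.cons_append, isReduced_cons_cons, ← List.cons_append]
        refine ⟨fun h => ?_, hv true⟩
        obtain ⟨b1, _ | _⟩ := b <;> simp_all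
  | cons a w ih =>
    cases v with
    | nil =>
      by_cases ha : a = (j, true)
      · subst ha
        refine .inl ⟨w, by simp, ?_⟩
        rw [mk_cons (j, true), mk_singleton_true]
        simp [conjOf, ← one_eq_mk]
      · refine .inr (.inr ⟨FreeGroup.invRev (a :: w), by simp [← one_eq_mk, inv_mk], ?_⟩)
        rw [← List.cons_append]
        refine List.isChain_append.2 ⟨hL hw, List.isChain_singleton _, ?_⟩
        rw [getLast?_cons_invRev_cons]
        obtain ⟨b1, _ | _⟩ := a <;> simp_all
    | cons b v =>
      by_cases hab : a = b
      · subst hab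
        have hw' : IsTight w i := fun c => (hw c).tail
        have hv' : IsTight v j := fun c => (hv c).tail
        rcases ih v hw' hv' with ⟨w', h1, h2⟩ | ⟨v', h1, h2⟩ | ⟨g, h1, h2⟩
        · refine .inl ⟨a :: w', by simpa, ?_⟩
          rw [mk_cons, h2, mk_cons a w, conjOf, conjOf, mk_cons a v]
          group
        · refine .inr (.inl ⟨a :: v', by simpa, ?_⟩)
          rw [mk_cons, h2, mk_cons a v, conjOf, conjOf, mk_cons a w]
          group
        · refine .inr (.inr ⟨g, ?_, h2⟩)
          rw [h1, mk_cons a w, mk_cons a v]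
          group
      · refine .inr (.inr ⟨FreeGroup.invRev (a :: w) ++ b :: v, by rw [inv_mk, mul_mk], ?_⟩)
        rw [List.append_assoc, ← List.cons_append]
        refine List.isChain_append.2 ⟨hL hw, hv true, ?_⟩
        rw [getLast?_cons_invRev_cons]
        obtain ⟨b1, _ | _⟩ := a <;> obtain ⟨c1, _ | _⟩ := b <;> simp_all

theorem eq_nil_of_gaps {w₁ g₁ g₂ u : List (α × Bool)} {i j k a b c : α}
    (h₁ : IsReduced (w₁ ++ [(i, true)])) (h₂ : IsReduced ((i, true) :: (g₁ ++ [(j, true)])))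
    (h₃ : IsReduced ((j, true) :: (g₂ ++ [(k, true)]))) (h₄ : IsReduced ((k, true) :: u))
    (h : mk w₁ * of i * mk g₁ * of j * mk g₂ * of k * mk u = of a * of b * of c) :
    w₁ = [] ∧ g₁ = [] ∧ g₂ = [] ∧ u = [] ∧ i = a ∧ j = b ∧ k = c := by
  have hL : IsReduced (w₁ ++ (i, true) :: (g₁ ++ (j, true) :: (g₂ ++ (k, true) :: u))) := by
    have e₃ : IsReduced ((j, true) :: (g₂ ++ (k, true) :: u)) :=
      List.isChain_cons_split.2 ⟨h₃, h₄⟩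
    have e₂ : IsReduced ((i, true) :: (g₁ ++ (j, true) :: (g₂ ++ (k, true) :: u))) :=
      List.isChain_cons_split.2 ⟨h₂, e₃⟩
    exact List.isChain_split.2 ⟨h₁, e₂⟩
  have hR : IsReduced [(a, true), (b, true), (c, true)] := by simp
  have := reduce.sound (L₁ := _ ++ _) (L₂ := [(a, true), (b, true), (c, true)])
    (by simpa only [of, mul_mk, List.append_assoc, List.cons_append, List.nil_append] using h)
  rw [hL.reduce_eq, hR.reduce_eq] at this
  have hl := congrArg List.length this
  simp only [List.length_append, List.length_cons, List.length_nil] at hl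
  have l₁ : w₁ = [] := List.eq_nil_of_length_eq_zero (by omega)
  have l₂ : g₁ = [] := List.eq_nil_of_length_eq_zero (by omega)
  have l₃ : g₂ = [] := List.eq_nil_of_length_eq_zero (by omega)
  have l₄ : u = [] := List.eq_nil_of_length_eq_zero (by omega)
  subst l₁ l₂ l₃ l₄
  simpa using this

end FreeGroup

/-- In a group generated by `x, y` with `x² = y³ = z`, every element is `zᵏ u w s` with
`u ∈ {1, y, y⁻¹}`, `s ∈ {1, x}` and `w` in the submonoid generated by `x y⁻¹` and `x⁻¹ y`. -/
theorem exists_normal_form {G : Type*} [Group G] {x y : G} (hxy : x * x = y * y * y)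
    {g : G} (hg : g ∈ Subgroup.closure {x, y}) :
    ∃ (k : ℤ) (u w s : G), (u = 1 ∨ u = y ∨ u = y⁻¹) ∧
      w ∈ Submonoid.closure {x * y⁻¹, x⁻¹ * y} ∧ (s = 1 ∨ s = x) ∧
      g = (x * x) ^ k * u * w * s := by
  set M := Submonoid.closure {x * y⁻¹, x⁻¹ * y} with hM
  have hm₁ : x * y⁻¹ ∈ M := Submonoid.subset_closure (by simp)
  have hm₂ : x⁻¹ * y ∈ M := Submonoid.subset_closure (by simp)
  let P : G → Prop := fun g => ∃ (k : ℤ) (u w s : G), (u = 1 ∨ u = y ∨ u = y⁻¹) ∧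
      w ∈ M ∧ (s = 1 ∨ s = x) ∧ g = (x * x) ^ k * u * w * s
  have hz : ∀ (k : ℤ) g, P g → P ((x * x) ^ k * g) := by
    rintro k g ⟨l, u, w, s, hu, hw, hs, rfl⟩
    exact ⟨k + l, u, w, s, hu, hw, hs, by rw [zpow_add]; group⟩
  have cx : ∀ k : ℤ, x * (x * x) ^ k = (x * x) ^ k * x := fun k =>
    ((Commute.refl x).mul_right (Commute.refl x)).zpow_right k
  have cy : ∀ k : ℤ, y * (x * x) ^ k = (x * x) ^ k * y := fun k => by
    rw [hxy]
    exact (((Commute.refl y).mul_right (Commute.refl y)).mul_right (Commute.refl y)).zpow_right k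
  have hy : ∀ g, P g → P (y * g) := by
    rintro g ⟨l, u, w, s, hu, hw, hs, rfl⟩
    have e : y * ((x * x) ^ l * u * w * s) = (x * x) ^ l * (y * u * w * s) := by
      simp only [← mul_assoc, cy]
    rw [e]
    apply hz
    rcases hu with rfl | rfl | rfl
    · exact ⟨0, y, w, s, by simp, hw, hs, by simp⟩
    · refine ⟨1, u⁻¹, w, s, by simp, hw, hs, ?_⟩
      rw [hxy]; group
    · exact ⟨0, 1, w, s, by simp, hw, hs, by simp⟩
  have hx : ∀ g, P g → P (x * g) := by
    rintro g ⟨l, u, w, s, hu, hw, hs, rfl⟩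
    have e : x * ((x * x) ^ l * u * w * s) = (x * x) ^ l * (x * u * w * s) := by
      simp only [← mul_assoc, cx]
    rw [e]
    apply hz
    rcases hu with rfl | rfl | rfl
    · induction hw using Submonoid.closure_induction_left with
      | one =>
        rcases hs with rfl | rfl
        · exact ⟨0, 1, 1, x, by simp, one_mem _, by simp, by simp⟩
        · exact ⟨1, 1, 1, 1, by simp, one_mem _, by simp, by simp⟩
      | mul_left m hm w' hw' _ =>
        rcases hm with rfl | rfl
        · exact ⟨1, y⁻¹, w', s, by simp, hw', hs, by group⟩
        · exact ⟨0, y, w', s, by simp, hw', hs, by group⟩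
    · exact ⟨1, 1, x⁻¹ * u * w, s, by simp, mul_mem hm₂ hw, hs, by group⟩
    · exact ⟨0, 1, x * y⁻¹ * w, s, by simp, mul_mem hm₁ hw, hs, by group⟩
  change P g
  induction hg using Subgroup.closure_induction_left with
  | one => exact ⟨0, 1, 1, 1, by simp, one_mem _, by simp, by simp⟩
  | mul_left a ha g _ ih =>
    rcases ha with rfl | rfl
    · exact hx _ ih
    · exact hy _ ih
  | inv_mul_cancel a ha g _ ih =>
    rcases ha with rfl | rfl
    · have := hz (-1) _ (hx _ ih)
      convert this using 1
      group
    · have := hz (-1) _ (hy _ (hy _ ih))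
      convert this using 1
      rw [hxy]; group

open FreeGroup hiding map_mul map_inv

/-- The automorphism `t₁ ↦ t₁t₂t₁⁻¹`, `t₂ ↦ t₁`, `t₃ ↦ t₃` of `F₃`. -/
def braidA : MulAut (FreeGroup (Fin 3)) :=
  MonoidHom.toMulEquiv (lift ![of 0 * of 1 * (of 0)⁻¹, of 0, of 2])
    (lift ![of 1, (of 1)⁻¹ * of 0 * of 1, of 2])
    (by ext i; fin_cases i <;> simp [mul_assoc]) (by ext i; fin_cases i <;> simp [mul_assoc])

/-- The automorphism `t₁ ↦ t₁`, `t₂ ↦ t₂t₃t₂⁻¹`, `t₃ ↦ t₂` of `F₃`. -/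
def braidB : MulAut (FreeGroup (Fin 3)) :=
  MonoidHom.toMulEquiv (lift ![of 0, of 1 * of 2 * (of 1)⁻¹, of 1])
    (lift ![of 0, of 2, (of 2)⁻¹ * of 1 * of 2])
    (by ext i; fin_cases i <;> simp [mul_assoc]) (by ext i; fin_cases i <;> simp [mul_assoc])

theorem braidA_apply (x) : braidA x = lift ![of 0 * of 1 * (of 0)⁻¹, of 0, of 2] x := rfl

theorem braidA_symm_apply (x) :
    MulEquiv.symm braidA x = lift ![of 1, (of 1)⁻¹ * of 0 * of 1, of 2] x := rfl

theorem braidB_apply (x) : braidB x = lift ![of 0, of 1 * of 2 * (of 1)⁻¹, of 1] x := rfl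

theorem braidB_symm_apply (x) :
    MulEquiv.symm braidB x = lift ![of 0, of 2, (of 2)⁻¹ * of 1 * of 2] x := rfl

theorem mulAut_ext {φ ψ : MulAut (FreeGroup (Fin 3))} (h₀ : φ (of 0) = ψ (of 0))
    (h₁ : φ (of 1) = ψ (of 1)) (h₂ : φ (of 2) = ψ (of 2)) : φ = ψ := by
  have : φ.toMonoidHom = ψ.toMonoidHom := by
    ext i; fin_cases i
    exacts [h₀, h₁, h₂]
  exact MulEquiv.toMonoidHom_injective this

theorem braid_relation : braidA * braidB * braidA = braidB * braidA * braidB := by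
  apply mulAut_ext <;> simp [braidA_apply, braidB_apply, mul_assoc]

theorem full_twist_eq_conj :
    braidA * braidB * braidA * (braidA * braidB * braidA) = MulAut.conj wordT := by
  apply mulAut_ext <;> simp [braidA_apply, braidB_apply, mul_assoc, wordT]

theorem image_punctureClasses3 (φ : MulAut (FreeGroup (Fin 3))) (π : Equiv.Perm (Fin 3))
    (h : ∀ k, IsConj (φ (of k)) (of (π k))) :
    ConjClasses.map φ.toMonoidHom '' punctureClasses3 = punctureClasses3 := by
  have key : ∀ k, ConjClasses.map φ.toMonoidHom (ConjClasses.mk (of k)⁻¹) =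
      ConjClasses.mk (of (π k))⁻¹ := fun k => by
    obtain ⟨c, hc⟩ := isConj_iff.1 (h k)
    refine ConjClasses.mk_eq_mk_iff_isConj.2 (isConj_iff.2 ⟨c, ?_⟩)
    rw [← hc, conj_inv]
    exact congrArg (c * · * c⁻¹) (map_inv φ _)
  rw [punctureClasses3, ← Set.range_comp]
  simp only [Function.comp_def, key]
  exact π.surjective.range_comp fun k => ConjClasses.mk (of k)⁻¹

theorem braidA_mem : braidA ∈ AM013carrier := by
  refine ⟨by simp [wordT, braidA_apply], image_punctureClasses3 _ (Equiv.swap 0 1) fun k => ?_⟩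
  fin_cases k
  · exact isConj_iff.2 ⟨(of 0)⁻¹, by simp [braidA_apply, mul_assoc]⟩
  · exact isConj_iff.2 ⟨1, by simp [braidA_apply]⟩
  · exact isConj_iff.2 ⟨1, by simp [braidA_apply, Equiv.swap_apply_of_ne_of_ne]⟩

theorem braidB_mem : braidB ∈ AM013carrier := by
  refine ⟨by simp [wordT, braidB_apply, mul_assoc],
    image_punctureClasses3 _ (Equiv.swap 1 2) fun k => ?_⟩
  fin_cases k
  · exact isConj_iff.2 ⟨1, by simp [braidB_apply, Equiv.swap_apply_of_ne_of_ne]⟩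
  · exact isConj_iff.2 ⟨(of 1)⁻¹, by simp [braidB_apply, mul_assoc]⟩
  · exact isConj_iff.2 ⟨1, by simp [braidB_apply]⟩

theorem mul_conjOf_mul_inv {g : FreeGroup (Fin 3)} {u v : List (Fin 3 × Bool)}
    (h : mk v = g * mk u) (i : Fin 3) : g * conjOf u i * g⁻¹ = conjOf v i := by
  rw [conjOf, conjOf, h]; group

/-- An automorphism fixing `t₁t₂t₃` which sends each generator to a conjugate of a generator is a
product of `braidA`, `braidB` and their inverses. -/
theorem mem_closure_of_conjOf {φ : MulAut (FreeGroup (Fin 3))} (u v w : List (Fin 3 × Bool))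
    (i j k : Fin 3) (h₀ : φ (of 0) = conjOf u i) (h₁ : φ (of 1) = conjOf v j)
    (h₂ : φ (of 2) = conjOf w k) (hφ : φ wordT = wordT) :
    φ ∈ Subgroup.closure {braidA, braidB} := by
  have hA : braidA ∈ Subgroup.closure {braidA, braidB} := Subgroup.subset_closure (by simp)
  have hB : braidB ∈ Subgroup.closure {braidA, braidB} := Subgroup.subset_closure (by simp)
  induction hn : u.length + v.length + w.length using Nat.strong_induction_on
    generalizing φ u v w i j k with
  | _ n ih =>
  subst hn
  rcases isTight_or_exists_shorter u i with hu | ⟨u', hl, hu'⟩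
  swap
  · exact ih _ (by omega) u' v w i j k (h₀.trans hu'.symm) h₁ h₂ hφ rfl
  rcases isTight_or_exists_shorter v j with hv | ⟨v', hl, hv'⟩
  swap
  · exact ih _ (by omega) u v' w i j k h₀ (h₁.trans hv'.symm) h₂ hφ rfl
  rcases isTight_or_exists_shorter w k with hw | ⟨w', hl, hw'⟩
  swap
  · exact ih _ (by omega) u v w' i j k h₀ h₁ (h₂.trans hw'.symm) hφ rfl
  have eA : braidA wordT = wordT := braidA_mem.1
  have eB : braidB wordT = wordT := braidB_mem.1
  have eA' : braidA⁻¹ wordT = wordT := (MulEquiv.symm_apply_eq _).2 eA.symm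
  have eB' : braidB⁻¹ wordT = wordT := (MulEquiv.symm_apply_eq _).2 eB.symm
  rcases exists_gap u v i j hu hv with ⟨u', hl, hu'⟩ | ⟨v', hl, hv'⟩ | ⟨g₁, hg₁, hr₁⟩
  · have : φ * braidA⁻¹ ∈ Subgroup.closure {braidA, braidB} := by
      refine ih _ ?_ v u' w j i k ?_ ?_ ?_ ?_ rfl
      · omega
      · simpa [braidA_symm_apply] using h₁
      · simpa [braidA_symm_apply, h₀, h₁] using mul_conjOf_mul_inv hu' i
      · simpa [braidA_symm_apply] using h₂
      · rw [MulAut.mul_apply, eA', hφ]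
    simpa using mul_mem this hA
  · have : φ * braidA ∈ Subgroup.closure {braidA, braidB} := by
      refine ih _ ?_ v' u w j i k ?_ ?_ ?_ ?_ rfl
      · omega
      · simpa [braidA_apply, h₀, h₁] using mul_conjOf_mul_inv hv' j
      · simpa [braidA_apply] using h₀
      · simpa [braidA_apply] using h₂
      · rw [MulAut.mul_apply, eA, hφ]
    simpa using mul_mem this (inv_mem hA)
  rcases exists_gap v w j k hv hw with ⟨v', hl, hv'⟩ | ⟨w', hl, hw'⟩ | ⟨g₂, hg₂, hr₂⟩
  · have : φ * braidB⁻¹ ∈ Subgroup.closure {braidA, braidB} := by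
      refine ih _ ?_ u w v' i k j ?_ ?_ ?_ ?_ rfl
      · omega
      · simpa [braidB_symm_apply] using h₀
      · simpa [braidB_symm_apply] using h₂
      · simpa [braidB_symm_apply, h₁, h₂] using mul_conjOf_mul_inv hv' j
      · rw [MulAut.mul_apply, eB', hφ]
    simpa using mul_mem this hB
  · have : φ * braidB ∈ Subgroup.closure {braidA, braidB} := by
      refine ih _ ?_ u w' v i k j ?_ ?_ ?_ ?_ rfl
      · omega
      · simpa [braidB_apply] using h₀
      · simpa [braidB_apply, h₁, h₂] using mul_conjOf_mul_inv hw' k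
      · simpa [braidB_apply] using h₁
      · rw [MulAut.mul_apply, eB, hφ]
    simpa using mul_mem this (inv_mem hB)
  have hw₄ : IsReduced ((k, true) :: invRev w) := by
    simpa [invRev] using (hw false).invRev
  have hword : mk u * of i * mk g₁ * of j * mk g₂ * of k * mk (invRev w) =
      of 0 * of 1 * of 2 := by
    rw [← inv_mk, hg₁, hg₂]
    rw [wordT, map_mul, map_mul, h₀, h₁, h₂] at hφ
    rw [← hφ, conjOf, conjOf, conjOf]
    group
  obtain ⟨rfl, rfl, rfl, hwn, rfl, rfl, rfl⟩ := eq_nil_of_gaps (hu true) hr₁ hr₂ hw₄ hword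
  have hw0 : w = [] := by
    rw [← invRev_invRev (L₁ := w), hwn, invRev_empty]
  subst hw0
  have hv1 : mk v = 1 := by
    simpa [← one_eq_mk] using hg₁.symm
  have : φ = 1 := by
    apply mulAut_ext
    · simp [h₀, conjOf, ← one_eq_mk]
    · simp [h₁, conjOf, hv1]
    · simp [h₂, conjOf, ← one_eq_mk]
  rw [this]
  exact one_mem _

theorem AM013carrier_subset_closure :
    AM013carrier ⊆ (Subgroup.closure {braidA, braidB} : Set (MulAut (FreeGroup (Fin 3)))) := by
  rintro φ ⟨hφ, hc⟩
  have key : ∀ k, ∃ u i, φ (of k) = conjOf u i := fun k => by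
    have hk : ConjClasses.map φ.toMonoidHom (ConjClasses.mk (of k)⁻¹) ∈ punctureClasses3 :=
      hc ▸ Set.mem_image_of_mem _ (Set.mem_range_self k)
    obtain ⟨i, hi⟩ := hk
    obtain ⟨c, hc⟩ := isConj_iff.1 (ConjClasses.mk_eq_mk_iff_isConj.1 hi)
    refine ⟨c.toWord, i, ?_⟩
    rw [conjOf, mk_toWord, ← inv_inj, conj_inv, hc]
    exact (map_inv φ _).symm
  obtain ⟨u, i, h₀⟩ := key 0
  obtain ⟨v, j, h₁⟩ := key 1
  obtain ⟨w, k, h₂⟩ := key 2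
  exact mem_closure_of_conjOf u v w i j k h₀ h₁ h₂ hφ

/-- The homomorphism from the three-strand braid group to `Aut(F₃)` given by `a ↦ braidA`,
`b ↦ braidB`. -/
def braidHom : PresentedGroup relAM013 →* MulAut (FreeGroup (Fin 3)) :=
  PresentedGroup.toGroup (f := ![braidA, braidB]) (by
    rintro r rfl
    simp [braid_relation])

/-- The standard homomorphism from the three-strand braid group to `GL(2, ℤ)`. -/
def braidMatrix : PresentedGroup relAM013 →* (Matrix (Fin 2) (Fin 2) ℤ)ˣ :=
  PresentedGroup.toGroup (f := ![⟨!![1, 1; 0, 1], !![1, -1; 0, 1], by decide, by decide⟩,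
    ⟨!![1, 0; -1, 1], !![1, 0; 1, 1], by decide, by decide⟩]) (by
    rintro r rfl
    simp only [map_mul, map_inv, mul_inv_eq_one, lift_apply_of]
    ext : 1
    simp)

/-- The homomorphism from `F₃` to the permutations of `ℤ` sending `tᵢ` to `x ↦ vᵢ - x`. -/
def reflectionHom (v : Fin 3 → ℤ) : FreeGroup (Fin 3) →* Equiv.Perm ℤ :=
  lift fun i => Equiv.subLeft (v i)

/-- Precomposition with `φ` acts on the homomorphisms `reflectionHom v` and thereby transforms
the row vector `(v₀ - v₁, v₁ - v₂)` by the matrix `M`. -/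
def ActsBy (φ : MulAut (FreeGroup (Fin 3))) (M : Matrix (Fin 2) (Fin 2) ℤ) : Prop :=
  ∀ v, ∃ v', (∀ x, reflectionHom v (φ x) = reflectionHom v' x) ∧
    v' 0 - v' 1 = (v 0 - v 1) * M 0 0 + (v 1 - v 2) * M 1 0 ∧
    v' 1 - v' 2 = (v 0 - v 1) * M 0 1 + (v 1 - v 2) * M 1 1

theorem ActsBy.mul {φ ψ : MulAut (FreeGroup (Fin 3))} {M N : Matrix (Fin 2) (Fin 2) ℤ}
    (hφ : ActsBy φ M) (hψ : ActsBy ψ N) : ActsBy (φ * ψ) (M * N) := by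
  intro v
  obtain ⟨v', h, e₁, e₂⟩ := hφ v
  obtain ⟨v'', h', e₁', e₂'⟩ := hψ v'
  refine ⟨v'', fun x => by rw [MulAut.mul_apply, h, h'], ?_, ?_⟩
  · rw [e₁', e₁, e₂, Matrix.mul_apply, Matrix.mul_apply, Fin.sum_univ_two, Fin.sum_univ_two]
    ring
  · rw [e₂', e₁, e₂, Matrix.mul_apply, Matrix.mul_apply, Fin.sum_univ_two, Fin.sum_univ_two]
    ring

theorem ActsBy.one : ActsBy 1 1 := fun v => ⟨v, by simp⟩

theorem actsBy_of_generators {φ : MulAut (FreeGroup (Fin 3))} {M : Matrix (Fin 2) (Fin 2) ℤ}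
    (f : (Fin 3 → ℤ) → Fin 3 → ℤ)
    (h : ∀ v i x, reflectionHom v (φ (of i)) x = f v i - x)
    (h₁ : ∀ v, f v 0 - f v 1 = (v 0 - v 1) * M 0 0 + (v 1 - v 2) * M 1 0)
    (h₂ : ∀ v, f v 1 - f v 2 = (v 0 - v 1) * M 0 1 + (v 1 - v 2) * M 1 1) : ActsBy φ M := by
  refine fun v => ⟨f v, fun x => ?_, h₁ v, h₂ v⟩
  have : (reflectionHom v).comp φ.toMonoidHom = reflectionHom (f v) := by
    ext i x
    simpa [reflectionHom] using h v i x
  exact DFunLike.congr_fun this x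

theorem actsBy_braidHom (g : PresentedGroup relAM013) :
    ActsBy (braidHom g) (braidMatrix g).1 := by
  have hg : g ∈ Subgroup.closure (Set.range (PresentedGroup.of (rels := relAM013))) := by
    rw [PresentedGroup.closure_range_of]; trivial
  induction hg using Subgroup.closure_induction'' with
  | one => simpa using ActsBy.one
  | mul x y _ _ hx hy => simpa using hx.mul hy
  | mem x hx =>
    obtain ⟨i, rfl⟩ := hx
    fin_cases i
    · refine actsBy_of_generators (fun v => ![2 * v 0 - v 1, v 0, v 2]) ?_ ?_ ?_
      · intro v i x
        fin_cases i <;> simp [braidHom, reflectionHom, braidA_apply] <;> ring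
      all_goals intro v; simp [braidMatrix]; try ring
    · refine actsBy_of_generators (fun v => ![v 0, 2 * v 1 - v 2, v 1]) ?_ ?_ ?_
      · intro v i x
        fin_cases i <;> simp [braidHom, reflectionHom, braidB_apply] <;> ring
      all_goals intro v; simp [braidMatrix]; try ring
  | inv_mem x hx =>
    obtain ⟨i, rfl⟩ := hx
    fin_cases i
    · refine actsBy_of_generators (fun v => ![v 1, 2 * v 1 - v 0, v 2]) ?_ ?_ ?_
      · intro v i x
        fin_cases i <;> simp [braidHom, reflectionHom, braidA_symm_apply] <;> ring
      all_goals
        intro v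
        simp [braidMatrix]
        try ring
    · refine actsBy_of_generators (fun v => ![v 0, v 2, 2 * v 2 - v 1]) ?_ ?_ ?_
      · intro v i x
        fin_cases i <;> simp [braidHom, reflectionHom, braidB_symm_apply] <;> ring
      all_goals
        intro v
        simp [braidMatrix]
        try ring

theorem braidMatrix_eq_one {g : PresentedGroup relAM013} (hg : braidHom g = 1) :
    braidMatrix g = 1 := by
  have key : ∀ v : Fin 3 → ℤ,
      v 0 - v 1 = (v 0 - v 1) * (braidMatrix g).1 0 0 + (v 1 - v 2) * (braidMatrix g).1 1 0 ∧
      v 1 - v 2 = (v 0 - v 1) * (braidMatrix g).1 0 1 + (v 1 - v 2) * (braidMatrix g).1 1 1 := by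
    intro v
    obtain ⟨v', h, e⟩ := actsBy_braidHom g v
    have : v' = v := by
      ext i
      have := DFunLike.congr_fun (h (of i)) 0
      simpa [hg, reflectionHom, eq_comm] using this
    rwa [this] at e
  have h₁ := key ![1, 0, 0]
  have h₂ := key ![1, 1, 0]
  simp at h₁ h₂
  ext i j
  fin_cases i <;> fin_cases j <;> simp [← h₁.1, ← h₁.2, ← h₂.1, ← h₂.2]

/-- The generator `a` of the three-strand braid group. -/
def genA : PresentedGroup relAM013 := PresentedGroup.of 0

/-- The generator `b` of the three-strand braid group. -/
def genB : PresentedGroup relAM013 := PresentedGroup.of 1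

theorem genA_mul_genB_mul_genA : genA * genB * genA = genB * genA * genB :=
  PresentedGroup.mk_eq_mk_of_mul_inv_mem (rels := relAM013) rfl

theorem braidMatrix_genA : (braidMatrix genA).1 = !![1, 1; 0, 1] := by
  simp [genA, braidMatrix]

theorem braidMatrix_genB : (braidMatrix genB).1 = !![1, 0; -1, 1] := by
  simp [genB, braidMatrix]

theorem braidMatrix_genB_inv : (braidMatrix genB⁻¹).1 = !![1, 0; 1, 1] := by
  simp [genB, braidMatrix]

theorem braidHom_genA : braidHom genA = braidA := by
  simp [genA, braidHom]

theorem braidHom_genB : braidHom genB = braidB := by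
  simp [genB, braidHom]

theorem braidMatrix_nonneg {w : PresentedGroup relAM013}
    (hw : w ∈ Submonoid.closure {genA, genB⁻¹}) :
    1 ≤ (braidMatrix w).1 0 0 ∧ 1 ≤ (braidMatrix w).1 1 1 ∧
    0 ≤ (braidMatrix w).1 0 1 ∧ 0 ≤ (braidMatrix w).1 1 0 ∧
    (w = 1 ∨ 1 ≤ (braidMatrix w).1 0 1 + (braidMatrix w).1 1 0) := by
  induction hw using Submonoid.closure_induction_left with
  | one => simp
  | mul_left m hm w _ ih =>
    rcases hm with rfl | rfl
    · simp only [map_mul, Units.val_mul, braidMatrix_genA]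
      simp [Matrix.mul_apply, Fin.sum_univ_two]
      omega
    · simp only [map_mul, Units.val_mul, braidMatrix_genB_inv]
      simp [Matrix.mul_apply, Fin.sum_univ_two]
      omega

theorem wordT_zpow_commute {k : ℤ} (h : wordT ^ k * of 0 = of 0 * wordT ^ k) : k = 0 := by
  have := congrArg (lift ![Equiv.subLeft (0 : ℤ), Equiv.subLeft 1, 1]) h
  have hw : lift ![Equiv.subLeft (0 : ℤ), Equiv.subLeft 1, 1] wordT = Equiv.addRight (-1) := by
    ext x
    simp [wordT]
    ring
  rw [map_mul, map_mul, map_zpow, hw] at this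
  have := DFunLike.congr_fun this 0
  simp at this
  omega

theorem neg_one_zpow_eq (k : ℤ) :
    (-1 : (Matrix (Fin 2) (Fin 2) ℤ)ˣ) ^ k = 1 ∨
    (-1 : (Matrix (Fin 2) (Fin 2) ℤ)ˣ) ^ k = -1 := by
  have h2 : (-1 : (Matrix (Fin 2) (Fin 2) ℤ)ˣ) ^ (2 : ℤ) = 1 := by
    rw [zpow_ofNat, neg_one_sq]
  rcases Int.even_or_odd' k with ⟨c, rfl | rfl⟩
  · left; rw [zpow_mul, h2, one_zpow]
  · right; rw [zpow_add, zpow_mul, h2, one_zpow, one_mul, zpow_one]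

theorem braidHom_injective : Function.Injective braidHom := by
  rw [injective_iff_map_eq_one]
  intro g hg
  obtain ⟨x, hx⟩ : ∃ x, x = genA * genB * genA := ⟨_, rfl⟩
  obtain ⟨y, hy⟩ : ∃ y, y = genB * genA := ⟨_, rfl⟩
  have hx' : x = genB * genA * genB := hx.trans genA_mul_genB_mul_genA
  have hxy : x * x = y * y * y := by
    rw [show x * x = genB * genA * genB * (genA * genB * genA) by rw [← hx', ← hx], hy]
    group
  have ha : x * y⁻¹ = genA := by rw [hx, hy]; group
  have hb : x⁻¹ * y = genB⁻¹ := by rw [hx', hy]; group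
  have hmem : g ∈ Subgroup.closure {x, y} := by
    refine PresentedGroup.generated_by _ _ (fun j => ?_) g
    have hxm : x ∈ Subgroup.closure {x, y} := Subgroup.subset_closure (by simp)
    have hym : y ∈ Subgroup.closure {x, y} := Subgroup.subset_closure (by simp)
    fin_cases j
    · change genA ∈ _
      rw [← ha]
      exact mul_mem hxm (inv_mem hym)
    · change genB ∈ _
      rw [← inv_mem_iff, ← hb]
      exact mul_mem (inv_mem hxm) hym
  obtain ⟨k, u, w, s, hu, hw, hs, rfl⟩ := exists_normal_form hxy hmem
  rw [ha, hb] at hw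
  have hX : (braidMatrix x).1 = !![0, 1; -1, 0] := by
    simp [hx, braidMatrix_genA, braidMatrix_genB]
  have hY : (braidMatrix y).1 = !![1, 1; -1, 0] := by
    simp [hy, braidMatrix_genA, braidMatrix_genB]
  have hY' : (braidMatrix y⁻¹).1 = !![0, -1; 1, 1] := by
    simp [hy, genA, genB, braidMatrix]
  have hZ : braidMatrix (x * x) = -1 := by
    ext i j
    rw [map_mul, Units.val_mul, hX]
    fin_cases i <;> fin_cases j <;> simp
  have hM := braidMatrix_eq_one hg
  rw [map_mul, map_mul, map_mul, map_zpow, hZ] at hM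
  obtain ⟨p₁, p₂, p₃, p₄, p₅⟩ := braidMatrix_nonneg hw
  have hE := congrArg Units.val hM
  simp only [Units.val_mul, Units.val_one] at hE
  rw [Matrix.eta_fin_two (braidMatrix w).1] at hE
  have hs' : (s = 1 ∧ (braidMatrix s).1 = 1) ∨ (braidMatrix s).1 = !![0, 1; -1, 0] := by
    rcases hs with rfl | rfl
    · simp
    · exact Or.inr hX
  have hu' : (u = 1 ∧ (braidMatrix u).1 = 1) ∨ (braidMatrix u).1 = !![1, 1; -1, 0] ∨
      (braidMatrix u).1 = !![0, -1; 1, 1] := by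
    rcases hu with rfl | rfl | rfl
    · simp
    · exact Or.inr (Or.inl hY)
    · exact Or.inr (Or.inr hY')
  have hk' : ((-1 : (Matrix (Fin 2) (Fin 2) ℤ)ˣ) ^ k).1 = 1 ∨
      ((-1 : (Matrix (Fin 2) (Fin 2) ℤ)ˣ) ^ k).1 = -1 := by
    rcases neg_one_zpow_eq k with h | h <;> simp [h]
  have huws : u = 1 ∧ w = 1 ∧ s = 1 := by
    generalize (braidMatrix w).1 0 0 = a, (braidMatrix w).1 0 1 = b,
      (braidMatrix w).1 1 0 = c, (braidMatrix w).1 1 1 = d at *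
    rcases hk' with hk | hk <;> rcases hu' with ⟨hu, hU⟩ | hU | hU <;>
      rcases hs' with ⟨hs, hS⟩ | hS <;>
      rw [hk, hU, hS] at hE <;>
      have e₁ := congrFun₂ hE 0 0 <;>
      have e₂ := congrFun₂ hE 0 1 <;>
      have e₃ := congrFun₂ hE 1 0 <;>
      have e₄ := congrFun₂ hE 1 1 <;>
      simp at e₁ e₂ e₃ e₄ <;>
      first
        | omega
        | exact ⟨hu, p₅.resolve_right (by omega), hs⟩
  obtain ⟨rfl, rfl, rfl⟩ := huws
  have hk : k = 0 := by
    simp only [mul_one, map_zpow, map_mul, hx, braidHom_genA, braidHom_genB,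
      full_twist_eq_conj] at hg
    rw [← map_zpow] at hg
    have := DFunLike.congr_fun hg (of 0)
    exact wordT_zpow_commute (mul_inv_eq_iff_eq_mul.1 (by simpa only [MulAut.conj_apply, MulAut.one_apply] using this))
  simp [hk]

theorem range_braidHom : braidHom.range = Subgroup.closure {braidA, braidB} := by
  rw [MonoidHom.range_eq_map, ← PresentedGroup.closure_range_of, MonoidHom.map_closure,
    ← Set.range_comp]
  congr 1
  ext φ
  simp [braidHom, Fin.exists_fin_two, eq_comm]

/-- The subgroup `AM_{0,1,3}` of `Aut(F₃)` consisting of the automorphisms fixing `t₁t₂t₃`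
and permuting the conjugacy classes `{[t₁⁻¹], [t₂⁻¹], [t₃⁻¹]}` is isomorphic to
`⟨a, b ∣ a·b·a = b·a·b⟩`. -/
theorem AM013_iso_presented
    (AM : Subgroup (MulAut (FreeGroup (Fin 3))))
    (hAM : (AM : Set (MulAut (FreeGroup (Fin 3)))) = AM013carrier) :
    Nonempty (AM ≃* PresentedGroup relAM013) := by
  have h : braidHom.range = AM := by
    rw [range_braidHom]
    refine le_antisymm ((Subgroup.closure_le _).2 ?_) ?_
    · rw [hAM, Set.insert_subset_iff, Set.singleton_subset_iff]
      exact ⟨braidA_mem, braidB_mem⟩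
    · rw [← SetLike.coe_subset_coe, hAM]
      exact AM013carrier_subset_closure
  subst h
  exact ⟨(MonoidHom.ofInjective braidHom_injective).symm⟩
end
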